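/- Let (X, B) be a weak solution on [0, 1/2] with X_0 = 0 of dX_t = b(X_t)dt + dB_t, where b(x) = −1/(2x) for 0 < |x| ≤ 1, b(0) = 0, and b measurable on |x| > 1. Let τ = inf{s ≥ 0 : |X_s| ≥ 1}. Then the stopped process (X_{t∧τ})^2 equals ∫_0^{t∧τ} 2 X_s dB_s + ∫_0^{t∧τ} 1_{{X_s = 0}} ds almost surely. -/

import Mathlib

open MeasureTheory ProbabilityTheory Set Filter
open scoped Classical

noncomputable section

/-- `B` is a Brownian motion with respect to the filtration `F` under `P`
(properties required for times `t ≥ 0`). -/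
def IsBrownian {Ω : Type*} [MeasurableSpace Ω] (F : ℝ → MeasurableSpace Ω)
    (P : Measure Ω) (B : ℝ → Ω → ℝ) : Prop :=
  (∀ ω, Continuous fun t => B t ω) ∧
  (∀ᵐ ω ∂P, B 0 ω = 0) ∧
  (∀ t, 0 ≤ t → Measurable[F t] (B t)) ∧
  (∀ s t, 0 ≤ s → s ≤ t →
    Indep (MeasurableSpace.comap (fun ω => B t ω - B s ω)
      (inferInstance : MeasurableSpace ℝ)) (F s) P) ∧
  (∀ s t, 0 ≤ s → s ≤ t →
    Measure.map (fun ω => B t ω - B s ω) P = gaussianReal 0 (Real.toNNReal (t - s)))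

/-- `(X, B)` is a weak solution on `[0, T]` of `dX = b(t, X) dt + dB` with
initial condition `x₀`, on a filtered space `(Ω, F, P)`. -/
def IsWeakSolutionOn {Ω : Type*} [m : MeasurableSpace Ω] (F : ℝ → MeasurableSpace Ω)
    (P : Measure Ω) (b : ℝ → ℝ → ℝ) (X B : ℝ → Ω → ℝ) (x₀ : Ω → ℝ) (T : ℝ) : Prop :=
  (∀ t, 0 ≤ t → F t ≤ m) ∧
  (∀ s t, 0 ≤ s → s ≤ t → F s ≤ F t) ∧
  IsBrownian F P B ∧
  (∀ ω, Continuous fun t => X t ω) ∧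
  (∀ t, 0 ≤ t → Measurable[F t] (X t)) ∧
  (∀ᵐ ω ∂P, X 0 ω = x₀ ω) ∧
  (∀ᵐ ω ∂P, ∀ t ∈ Set.Icc (0 : ℝ) T,
    IntegrableOn (fun s => b s (X s ω)) (Set.Icc 0 t) ∧
    X t ω = x₀ ω + (∫ s in (0:ℝ)..t, b s (X s ω)) + B t ω)

/-- The drift `b(x) = -1/(2x)` for `0 < |x| ≤ 1`, `b(0) = 0`, and `b(x) = f(x)`
for `|x| > 1`. -/
def bSing (f : ℝ → ℝ) (x : ℝ) : ℝ :=
  if x ≠ 0 ∧ |x| ≤ 1 then -1 / (2 * x) else if 1 < |x| then f x else 0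

/-- `I` is the Itô integral `∫₀ᵗ H dB`: left-endpoint dyadic Riemann sums
converge in probability. -/
def IsItoIntegral {Ω : Type*} [MeasurableSpace Ω] (P : Measure Ω)
    (B : ℝ → Ω → ℝ) (H : ℝ → Ω → ℝ) (I : ℝ → Ω → ℝ) : Prop :=
  ∀ t : ℝ, 0 ≤ t →
    TendstoInMeasure P
      (fun (n : ℕ) ω => ∑ i ∈ Finset.range (2 ^ n),
        H ((i : ℝ) * t / 2 ^ n) ω *
          (B (((i : ℝ) + 1) * t / 2 ^ n) ω - B ((i : ℝ) * t / 2 ^ n) ω))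
      atTop (I t)

open scoped Topology

/-- Centred square integrable variables with geometrically decaying variances tend to zero
almost surely. -/
lemma ae_tendsto_sub_integral_of_variance_le {Ω : Type*} [MeasurableSpace Ω] {P : Measure Ω}
    [IsProbabilityMeasure P] {Y : ℕ → Ω → ℝ} {C : ℝ} (hY : ∀ n, MemLp (Y n) 2 P)
    (hvar : ∀ n, variance (Y n) P ≤ C * (1 / 2) ^ n) :
    ∀ᵐ ω ∂P, Tendsto (fun n => Y n ω - ∫ ω', Y n ω' ∂P) atTop (𝓝 0) := by
  have hmeas : ∀ n, AEMeasurable (fun ω => ENNReal.ofReal ((Y n ω - ∫ ω', Y n ω' ∂P) ^ 2)) P :=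
    fun n => (((hY n).aestronglyMeasurable.aemeasurable.sub_const _).pow_const 2).ennreal_ofReal
  have hsum : Summable fun n : ℕ => C * (1 / 2 : ℝ) ^ n :=
    summable_geometric_two.mul_left C
  have hfin : ∫⁻ ω, ∑' n, ENNReal.ofReal ((Y n ω - ∫ ω', Y n ω' ∂P) ^ 2) ∂P ≠ ⊤ := by
    rw [lintegral_tsum hmeas]
    refine ne_top_of_le_ne_top hsum.tsum_ofReal_ne_top (ENNReal.tsum_le_tsum fun n => ?_)
    rw [← evariance_eq_lintegral_ofReal, ← ofReal_variance (hY n)]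
    exact ENNReal.ofReal_le_ofReal (hvar n)
  filter_upwards [ae_lt_top' (AEMeasurable.tsum hmeas) hfin] with ω hω
  have h0 := ENNReal.tendsto_atTop_zero_of_tsum_ne_top hω.ne
  have h1 := (ENNReal.tendsto_toReal ENNReal.zero_ne_top).comp h0
  have h2 : Tendsto (fun n => (Y n ω - ∫ ω', Y n ω' ∂P) ^ 2) atTop (𝓝 0) := by
    refine h1.congr fun n => ?_
    simp [ENNReal.toReal_ofReal (sq_nonneg _)]
  have h3 := h2.sqrt
  simp only [Real.sqrt_sq_eq_abs, Real.sqrt_zero] at h3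
  exact (tendsto_zero_iff_abs_tendsto_zero _).2 h3

lemma gaussianReal_zero_eq_map (v : NNReal) :
    gaussianReal 0 v = (gaussianReal 0 1).map (fun x => √(v : ℝ) * x) := by
  rw [gaussianReal_map_const_mul]
  congr 1
  · simp
  · ext; simp

lemma memLp_sq_gaussianReal (v : NNReal) :
    MemLp (fun x : ℝ => x ^ 2) 2 (gaussianReal 0 v) := by
  have h : MemLp (fun x : ℝ => x) 4 (gaussianReal 0 v) := memLp_id_gaussianReal 4
  have := h.norm_rpow_div (2 : ENNReal)
  norm_num at this
  have e : (4 / 2 : ENNReal) = 2 := by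
    rw [ENNReal.div_eq_inv_mul, show (4 : ENNReal) = 2 * 2 by norm_num, ← mul_assoc,
      ENNReal.inv_mul_cancel (by norm_num) (by norm_num), one_mul]
  simpa [e] using this

lemma variance_sq_gaussianReal (v : NNReal) :
    variance (fun x : ℝ => x ^ 2) (gaussianReal 0 v) =
      (v : ℝ) ^ 2 * variance (fun x : ℝ => x ^ 2) (gaussianReal 0 1) := by
  conv_lhs => rw [gaussianReal_zero_eq_map v]
  rw [variance_map (by fun_prop) (by fun_prop), ← variance_const_mul]
  congr 1
  ext x
  simp [mul_pow, Real.sq_sqrt]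

lemma integral_sq_gaussianReal (v : NNReal) :
    ∫ x, x ^ 2 ∂(gaussianReal 0 v) = v := by
  have h := variance_fun_id_gaussianReal (μ := 0) (v := v)
  rw [variance_eq_integral (by fun_prop)] at h
  simpa using h

namespace IsBrownian

variable {Ω : Type*} [m : MeasurableSpace Ω] {F : ℝ → MeasurableSpace Ω} {P : Measure Ω}
  {B : ℝ → Ω → ℝ}

lemma measurable (hB : IsBrownian F P B) (hFm : ∀ t, 0 ≤ t → F t ≤ m) {t : ℝ} (ht : 0 ≤ t) :
    Measurable (B t) :=
  (hB.2.2.1 t ht).mono (hFm t ht) le_rfl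

lemma memLp_sq_increment (hB : IsBrownian F P B) (hFm : ∀ t, 0 ≤ t → F t ≤ m) {s t : ℝ}
    (hs : 0 ≤ s) (hst : s ≤ t) : MemLp (fun ω => (B t ω - B s ω) ^ 2) 2 P := by
  have hm : AEMeasurable (fun ω => B t ω - B s ω) P :=
    ((hB.measurable hFm (hs.trans hst)).sub (hB.measurable hFm hs)).aemeasurable
  have h := memLp_sq_gaussianReal (t - s).toNNReal
  rw [← hB.2.2.2.2 s t hs hst] at h
  exact h.comp_of_map hm

lemma integral_sq_increment (hB : IsBrownian F P B) (hFm : ∀ t, 0 ≤ t → F t ≤ m) {s t : ℝ}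
    (hs : 0 ≤ s) (hst : s ≤ t) : ∫ ω, (B t ω - B s ω) ^ 2 ∂P = t - s := by
  have hm : AEMeasurable (fun ω => B t ω - B s ω) P :=
    ((hB.measurable hFm (hs.trans hst)).sub (hB.measurable hFm hs)).aemeasurable
  have h := integral_sq_gaussianReal (t - s).toNNReal
  rw [← hB.2.2.2.2 s t hs hst, integral_map hm (by fun_prop)] at h
  rw [h, Real.coe_toNNReal _ (sub_nonneg.2 hst)]

lemma variance_sq_increment (hB : IsBrownian F P B) (hFm : ∀ t, 0 ≤ t → F t ≤ m) {s t : ℝ}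
    (hs : 0 ≤ s) (hst : s ≤ t) :
    variance (fun ω => (B t ω - B s ω) ^ 2) P =
      (t - s) ^ 2 * variance (fun x : ℝ => x ^ 2) (gaussianReal 0 1) := by
  have hm : AEMeasurable (fun ω => B t ω - B s ω) P :=
    ((hB.measurable hFm (hs.trans hst)).sub (hB.measurable hFm hs)).aemeasurable
  have h := variance_sq_gaussianReal (t - s).toNNReal
  rw [← hB.2.2.2.2 s t hs hst, variance_map (by fun_prop) hm,
    Real.coe_toNNReal _ (sub_nonneg.2 hst)] at h
  exact h

lemma indepFun_sq_increment (hB : IsBrownian F P B) (hF : ∀ s t, 0 ≤ s → s ≤ t → F s ≤ F t)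
    {s t u v : ℝ} (hs : 0 ≤ s) (hst : s ≤ t) (htu : t ≤ u) (huv : u ≤ v) :
    IndepFun (fun ω => (B t ω - B s ω) ^ 2) (fun ω => (B v ω - B u ω) ^ 2) P := by
  have ht := hs.trans hst
  have hu := ht.trans htu
  have h : IndepFun (fun ω => B t ω - B s ω) (fun ω => B v ω - B u ω) P := by
    refine (IndepFun_iff_Indep _ _ _).2 ?_
    refine indep_of_indep_of_le_left (hB.2.2.2.1 u v hu huv).symm ?_
    refine Measurable.comap_le ?_
    exact ((hB.2.2.1 t ht).mono (hF t u ht htu) le_rfl).sub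
      ((hB.2.2.1 s hs).mono (hF s u hs (hst.trans htu)) le_rfl)
  exact h.comp (φ := fun x : ℝ => x ^ 2) (ψ := fun x : ℝ => x ^ 2) (by fun_prop) (by fun_prop)

end IsBrownian

/-- The sum of the squared increments of `B` over the first `k` cells of the dyadic partition of
`[0, t]` into `2 ^ n` cells. -/
def dyadicSqSum (B : ℝ → ℝ) (t : ℝ) (n k : ℕ) : ℝ :=
  ∑ i ∈ Finset.range k,
    (B (((i : ℝ) + 1) * t / 2 ^ n) - B ((i : ℝ) * t / 2 ^ n)) ^ 2

lemma dyadicSqSum_mono (B : ℝ → ℝ) (t : ℝ) (n : ℕ) : Monotone (dyadicSqSum B t n) := by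
  intro k l hkl
  exact Finset.sum_le_sum_of_subset_of_nonneg (Finset.range_mono hkl)
    fun _ _ _ => sq_nonneg _

/-- For a Brownian motion, the dyadic sums of squared increments over `k n ≤ 2 ^ n` cells
are asymptotically equal to the elapsed time, almost surely. -/
lemma IsBrownian.ae_tendsto_dyadicSqSum_sub {Ω : Type*} [m : MeasurableSpace Ω]
    {F : ℝ → MeasurableSpace Ω} {P : Measure Ω} [IsProbabilityMeasure P] {B : ℝ → Ω → ℝ}
    (hB : IsBrownian F P B) (hFm : ∀ t, 0 ≤ t → F t ≤ m)
    (hF : ∀ s t, 0 ≤ s → s ≤ t → F s ≤ F t) {t : ℝ} (ht : 0 ≤ t) {k : ℕ → ℕ}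
    (hk : ∀ n, k n ≤ 2 ^ n) :
    ∀ᵐ ω ∂P, Tendsto (fun n => dyadicSqSum (fun s => B s ω) t n (k n) - k n * t / 2 ^ n)
      atTop (𝓝 0) := by
  set V := variance (fun x : ℝ => x ^ 2) (gaussianReal 0 1)
  have hV : 0 ≤ V := variance_nonneg _ _
  have h0 : ∀ n i : ℕ, 0 ≤ (i : ℝ) * t / 2 ^ n := fun n i => by positivity
  have hle : ∀ n i : ℕ, (i : ℝ) * t / 2 ^ n ≤ ((i : ℝ) + 1) * t / 2 ^ n := fun n i => by
    gcongr; linarith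
  have hmono : ∀ n i j : ℕ, i < j → ((i : ℝ) + 1) * t / 2 ^ n ≤ (j : ℝ) * t / 2 ^ n :=
    fun n i j hij => by gcongr; exact_mod_cast hij
  have hd : ∀ n i : ℕ, ((i : ℝ) + 1) * t / 2 ^ n - (i : ℝ) * t / 2 ^ n = t / 2 ^ n :=
    fun n i => by ring
  have hmem : ∀ n i : ℕ, MemLp (fun ω =>
      (B (((i : ℝ) + 1) * t / 2 ^ n) ω - B ((i : ℝ) * t / 2 ^ n) ω) ^ 2) 2 P :=
    fun n i => hB.memLp_sq_increment hFm (h0 n i) (hle n i)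
  have key := ae_tendsto_sub_integral_of_variance_le (P := P) (C := t ^ 2 * V)
    (Y := fun n ω => dyadicSqSum (fun s => B s ω) t n (k n))
    (fun n => memLp_finsetSum _ fun i _ => hmem n i) (fun n => by
      have hs := IndepFun.variance_sum (μ := P) (s := Finset.range (k n)) (X := fun (i : ℕ) ω =>
        (B (((i : ℝ) + 1) * t / 2 ^ n) ω - B ((i : ℝ) * t / 2 ^ n) ω) ^ 2)
        (fun i _ => hmem n i) (fun i _ j _ hij => by
          rcases lt_or_gt_of_ne hij with h | h
          · exact hB.indepFun_sq_increment hF (h0 n i) (hle n i) (hmono n i j h) (hle n j)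
          · exact (hB.indepFun_sq_increment hF (h0 n j) (hle n j) (hmono n j i h)
              (hle n i)).symm)
      have he : (fun ω => dyadicSqSum (fun s => B s ω) t n (k n)) =
          ∑ i ∈ Finset.range (k n), fun ω : Ω =>
            (B (((i : ℝ) + 1) * t / 2 ^ n) ω - B ((i : ℝ) * t / 2 ^ n) ω) ^ 2 := by
        ext ω; simp [dyadicSqSum]
      rw [he, hs, Finset.sum_congr rfl fun i _ =>
        (hB.variance_sq_increment hFm (h0 n i) (hle n i)).trans (by rw [hd n i])]
      rw [Finset.sum_const, Finset.card_range, nsmul_eq_mul]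
      calc (k n : ℝ) * ((t / 2 ^ n) ^ 2 * V)
          ≤ 2 ^ n * ((t / 2 ^ n) ^ 2 * V) := by gcongr; exact_mod_cast hk n
        _ = t ^ 2 * V * (1 / 2) ^ n := by
          rw [one_div, inv_pow]; field_simp)
  filter_upwards [key] with ω hω
  refine hω.congr fun n => ?_
  congr 1
  simp only [dyadicSqSum]
  rw [integral_finsetSum _ fun i _ => (hmem n i).integrable (by norm_num),
    Finset.sum_congr rfl fun i _ =>
      (hB.integral_sq_increment hFm (h0 n i) (hle n i)).trans (hd n i)]
  simp [mul_div_assoc]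

/-- The number of dyadic points `i * t / 2 ^ n`, `0 ≤ i < 2 ^ n`, lying in `[0, x]`. -/
def dyadicCount (t : ℝ) (n : ℕ) (x : ℝ) : ℕ := min (2 ^ n) (⌊x * 2 ^ n / t⌋₊ + 1)

lemma dyadicCount_le (t : ℝ) (n : ℕ) (x : ℝ) : dyadicCount t n x ≤ 2 ^ n := min_le_left _ _

lemma dyadicCount_mono {t : ℝ} (ht : 0 < t) (n : ℕ) : Monotone (dyadicCount t n) := by
  intro x y hxy
  unfold dyadicCount
  gcongr

lemma lt_dyadicCount_iff {t x : ℝ} (ht : 0 < t) (hx : 0 ≤ x) {n i : ℕ} (hi : i < 2 ^ n) :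
    i < dyadicCount t n x ↔ (i : ℝ) * t / 2 ^ n ≤ x := by
  rw [dyadicCount, lt_min_iff, Nat.lt_succ_iff, Nat.le_floor_iff (by positivity),
    le_div_iff₀ ht, div_le_iff₀ (by positivity)]
  simp [hi]

lemma tendsto_dyadicCount {t : ℝ} (ht : 0 < t) (x : ℝ) :
    Tendsto (fun n => (dyadicCount t n x : ℝ) * t / 2 ^ n) atTop (𝓝 (min t (max x 0))) := by
  have hδ : Tendsto (fun n : ℕ => min t (max x 0) + t / 2 ^ n) atTop (𝓝 (min t (max x 0))) := by
    have := (tendsto_pow_atTop_nhds_zero_of_lt_one (r := (1 / 2 : ℝ))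
      (by norm_num) (by norm_num)).const_mul t |>.const_add (min t (max x 0))
    simpa [div_eq_mul_inv] using this
  refine tendsto_of_tendsto_of_tendsto_of_le_of_le tendsto_const_nhds hδ (fun n => ?_)
    (fun n => ?_)
  all_goals
    have hp : (0 : ℝ) < 2 ^ n := by positivity
    have hcast : (dyadicCount t n x : ℝ) = min (2 ^ n) ((⌊x * 2 ^ n / t⌋₊ : ℝ) + 1) := by
      simp [dyadicCount]
    have h1 : x * 2 ^ n < ((⌊x * 2 ^ n / t⌋₊ : ℝ) + 1) * t :=
      (div_lt_iff₀ ht).1 (Nat.lt_floor_add_one _)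
    have h2 : (⌊x * 2 ^ n / t⌋₊ : ℝ) * t ≤ max x 0 * 2 ^ n := by
      rw [← le_div_iff₀ ht]
      refine (Nat.cast_le.2 (Nat.floor_mono ?_)).trans (Nat.floor_le (by positivity))
      gcongr
      exact le_max_left _ _
    dsimp only
    rw [hcast]
  · rw [le_div_iff₀ hp]
    rcases min_cases (2 ^ n : ℝ) ((⌊x * 2 ^ n / t⌋₊ : ℝ) + 1) with ⟨h, _⟩ | ⟨h, _⟩ <;> rw [h]
    · nlinarith [min_le_left t (max x 0)]
    · have h3 : max x 0 * 2 ^ n ≤ ((⌊x * 2 ^ n / t⌋₊ : ℝ) + 1) * t := by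
        rw [max_mul_of_nonneg _ _ hp.le]
        exact max_le h1.le (by rw [zero_mul]; positivity)
      nlinarith [min_le_right t (max x 0)]
  · rw [div_le_iff₀ hp, add_mul, div_mul_cancel₀ _ hp.ne']
    rcases min_cases t (max x 0) with ⟨h, _⟩ | ⟨h, _⟩ <;> rw [h]
    · nlinarith [min_le_left (2 ^ n : ℝ) ((⌊x * 2 ^ n / t⌋₊ : ℝ) + 1)]
    · nlinarith [min_le_right (2 ^ n : ℝ) ((⌊x * 2 ^ n / t⌋₊ : ℝ) + 1)]

/-- Monotone functions converging at all rationals to a continuous function converge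
everywhere. -/
lemma tendsto_of_monotone_of_tendsto_rat {g : ℕ → ℝ → ℝ} {h : ℝ → ℝ} (hg : ∀ n, Monotone (g n))
    (hh : Continuous h) (hq : ∀ q : ℚ, Tendsto (fun n => g n q) atTop (𝓝 (h q))) (x : ℝ) :
    Tendsto (fun n => g n x) atTop (𝓝 (h x)) := by
  refine tendsto_order.2 ⟨fun a ha => ?_, fun a ha => ?_⟩
  · have hev : ∀ᶠ y in 𝓝[<] x, a < h y :=
      (hh.tendsto x).mono_left nhdsWithin_le_nhds (lt_mem_nhds ha)
    obtain ⟨l, hl, hl'⟩ := (mem_nhdsLT_iff_exists_Ioo_subset).1 hev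
    obtain ⟨q, hq1, hq2⟩ := exists_rat_btwn (show l < x from hl)
    filter_upwards [(hq q).eventually (lt_mem_nhds (hl' ⟨hq1, hq2⟩))] with n hn
    exact hn.trans_le (hg n hq2.le)
  · have hev : ∀ᶠ y in 𝓝[>] x, h y < a :=
      (hh.tendsto x).mono_left nhdsWithin_le_nhds (gt_mem_nhds ha)
    obtain ⟨l, hl, hl'⟩ := (mem_nhdsGT_iff_exists_Ioo_subset).1 hev
    obtain ⟨q, hq1, hq2⟩ := exists_rat_btwn (show x < l from hl)
    filter_upwards [(hq q).eventually (gt_mem_nhds (hl' ⟨hq1, hq2⟩))] with n hn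
    exact (hg n hq1.le).trans_lt hn

/-- The dyadic quadratic variation of a Brownian motion, simultaneously at all times. -/
lemma IsBrownian.ae_forall_tendsto_dyadicSqSum {Ω : Type*} [m : MeasurableSpace Ω]
    {F : ℝ → MeasurableSpace Ω} {P : Measure Ω} [IsProbabilityMeasure P] {B : ℝ → Ω → ℝ}
    (hB : IsBrownian F P B) (hFm : ∀ t, 0 ≤ t → F t ≤ m)
    (hF : ∀ s t, 0 ≤ s → s ≤ t → F s ≤ F t) {t : ℝ} (ht : 0 < t) :
    ∀ᵐ ω ∂P, ∀ x : ℝ, Tendsto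
      (fun n => dyadicSqSum (fun s => B s ω) t n (dyadicCount t n x)) atTop
      (𝓝 (min t (max x 0))) := by
  have h : ∀ᵐ ω ∂P, ∀ q : ℚ, Tendsto (fun n =>
      dyadicSqSum (fun s => B s ω) t n (dyadicCount t n q) - dyadicCount t n q * t / 2 ^ n)
      atTop (𝓝 0) :=
    ae_all_iff.2 fun q => hB.ae_tendsto_dyadicSqSum_sub hFm hF ht.le
      fun n => dyadicCount_le t n q
  filter_upwards [h] with ω hω x
  refine tendsto_of_monotone_of_tendsto_rat
    (g := fun n x => dyadicSqSum (fun s => B s ω) t n (dyadicCount t n x))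
    (h := fun x => min t (max x 0))
    (fun n => (dyadicSqSum_mono _ t n).comp (dyadicCount_mono ht n)) (by fun_prop)
    (fun q => ?_) x
  simpa using (hω q).add (tendsto_dyadicCount ht (q : ℝ))

/-- Error bound on one cell for the left-endpoint expansion of `x ^ 2`. -/
lemma abs_sq_increment_error_le {x B β : ℝ → ℝ} (hx : Continuous x) {a c ε : ℝ} (hac : a ≤ c)
    (hβ : IntervalIntegrable β volume a c)
    (hinc : x c - x a = (∫ s in a..c, β s) + (B c - B a))
    (hosc : ∀ s ∈ Icc a c, |x s - x a| ≤ ε) (hoscB : |B c - B a| ≤ ε) :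
    |2 * x a * (B c - B a) -
      (x c ^ 2 - x a ^ 2 - (B c - B a) ^ 2 - ∫ s in a..c, 2 * x s * β s)|
      ≤ 4 * ε * ∫ s in a..c, |β s| := by
  have hxβ : IntervalIntegrable (fun s => 2 * x s * β s) volume a c :=
    hβ.continuousOn_mul (by fun_prop)
  have hI : ∫ s in a..c, 2 * (x s - x a) * β s =
      (∫ s in a..c, 2 * x s * β s) - 2 * x a * ∫ s in a..c, β s := by
    rw [← intervalIntegral.integral_const_mul, ← intervalIntegral.integral_sub hxβ
      (hβ.const_mul _)]
    congr 1; ext s; ring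
  have habs : IntervalIntegrable (fun s => |β s|) volume a c := hβ.abs
  have h1 : |∫ s in a..c, 2 * (x s - x a) * β s| ≤ 2 * ε * ∫ s in a..c, |β s| := by
    rw [← intervalIntegral.integral_const_mul, ← Real.norm_eq_abs]
    refine intervalIntegral.norm_integral_le_of_norm_le hac (ae_of_all _ fun s hs => ?_)
      (habs.const_mul _)
    have := hosc s (Ioc_subset_Icc_self hs)
    rw [Real.norm_eq_abs, abs_mul, abs_mul, abs_two]
    gcongr
  have h2 : |∫ s in a..c, β s| ≤ ∫ s in a..c, |β s| :=
    intervalIntegral.abs_integral_le_integral_abs hac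
  have h3 : |(x c - x a) + (B c - B a)| ≤ 2 * ε :=
    (abs_add_le _ _).trans (by linarith [hosc c (right_mem_Icc.2 hac)])
  have h4 : |(∫ s in a..c, β s) * ((x c - x a) + (B c - B a))|
      ≤ (∫ s in a..c, |β s|) * (2 * ε) := by
    rw [abs_mul]
    exact mul_le_mul h2 h3 (abs_nonneg _) ((abs_nonneg _).trans h2)
  have h5 : 2 * x a * (B c - B a) -
      (x c ^ 2 - x a ^ 2 - (B c - B a) ^ 2 - ∫ s in a..c, 2 * x s * β s) =
      (∫ s in a..c, 2 * (x s - x a) * β s) -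
        (∫ s in a..c, β s) * ((x c - x a) + (B c - B a)) := by
    rw [hI]
    have e : (∫ s in a..c, β s) = (x c - x a) - (B c - B a) := by linarith
    rw [e]; ring
  rw [h5]
  refine (abs_sub _ _).trans ?_
  linarith

/-- Pathwise Itô formula for `x ↦ x ^ 2` along dyadic partitions: if `x - B` is absolutely
continuous with derivative `β` and `B` has quadratic variation `σ` along the first `k n` cells,
then the left-endpoint sums over these cells converge. -/
lemma tendsto_dyadic_ito_sq {x B β : ℝ → ℝ} {t σ : ℝ} (ht : 0 < t) (hx : Continuous x)
    (hB : Continuous B) (hβ : IntervalIntegrable β volume 0 t)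
    (hxB : ∀ s ∈ Icc 0 t, x s = (∫ r in (0 : ℝ)..s, β r) + B s) {k : ℕ → ℕ}
    (hk : ∀ n, k n ≤ 2 ^ n) (hkσ : Tendsto (fun n => (k n : ℝ) * t / 2 ^ n) atTop (𝓝 σ))
    (hq : Tendsto (fun n => dyadicSqSum B t n (k n)) atTop (𝓝 σ)) :
    Tendsto (fun n => ∑ i ∈ Finset.range (k n), 2 * x ((i : ℝ) * t / 2 ^ n) *
      (B (((i : ℝ) + 1) * t / 2 ^ n) - B ((i : ℝ) * t / 2 ^ n))) atTop
      (𝓝 (x σ ^ 2 - x 0 ^ 2 - σ - ∫ s in (0 : ℝ)..σ, 2 * x s * β s)) := by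
  have hmem : ∀ n, (k n : ℝ) * t / 2 ^ n ∈ Icc 0 t := fun n => by
    refine ⟨by positivity, ?_⟩
    rw [div_le_iff₀ (by positivity), mul_comm]
    gcongr
    exact_mod_cast hk n
  have hσ : σ ∈ Icc 0 t := isClosed_Icc.mem_of_tendsto hkσ (Eventually.of_forall hmem)
  have hsub : ∀ {a c : ℝ}, a ∈ Icc 0 t → c ∈ Icc 0 t → IntervalIntegrable β volume a c :=
    fun ha hc => hβ.mono_set (by
      rw [uIcc_of_le ht.le]; exact uIcc_subset_Icc ha hc)
  have hxβ : IntervalIntegrable (fun s => 2 * x s * β s) volume 0 t :=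
    hβ.continuousOn_mul (by fun_prop)
  have hsubx : ∀ {a c : ℝ}, a ∈ Icc 0 t → c ∈ Icc 0 t →
      IntervalIntegrable (fun s => 2 * x s * β s) volume a c :=
    fun ha hc => hxβ.mono_set (by
      rw [uIcc_of_le ht.le]; exact uIcc_subset_Icc ha hc)
  have h0 : (0 : ℝ) ∈ Icc 0 t := ⟨le_rfl, ht.le⟩
  have hmain : Tendsto (fun n => x (k n * t / 2 ^ n) ^ 2 - x 0 ^ 2 - dyadicSqSum B t n (k n) -
      ∫ s in (0 : ℝ)..(k n * t / 2 ^ n), 2 * x s * β s) atTop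
      (𝓝 (x σ ^ 2 - x 0 ^ 2 - σ - ∫ s in (0 : ℝ)..σ, 2 * x s * β s)) := by
    refine (((((hx.tendsto σ).comp hkσ).pow 2).sub_const _).sub hq).sub ?_
    have hc : ContinuousOn (fun y => ∫ s in (0 : ℝ)..y, 2 * x s * β s) (Icc 0 t) := by
      have := intervalIntegral.continuousOn_primitive_interval'
        hxβ (left_mem_uIcc)
      rwa [uIcc_of_le ht.le] at this
    exact (hc σ hσ).tendsto.comp (tendsto_nhdsWithin_iff.2 ⟨hkσ, Eventually.of_forall hmem⟩)
  refine tendsto_of_tendsto_of_dist hmain ?_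
  set M := ∫ s in (0 : ℝ)..t, |β s| with hM
  have hM0 : 0 ≤ M := intervalIntegral.integral_nonneg ht.le fun _ _ => abs_nonneg _
  rw [Metric.tendsto_atTop]
  intro η hη
  set ε := η / (4 * M + 1) with hεdef
  have hε : 0 < ε := by positivity
  have hεM : 4 * ε * M < η := by
    have : ε * (4 * M + 1) = η := div_mul_cancel₀ _ (by positivity)
    nlinarith
  obtain ⟨d₁, hd₁, hux⟩ := Metric.uniformContinuousOn_iff.1
    (isCompact_Icc.uniformContinuousOn_of_continuous (s := Icc 0 t) hx.continuousOn) ε hε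
  obtain ⟨d₂, hd₂, huB⟩ := Metric.uniformContinuousOn_iff.1
    (isCompact_Icc.uniformContinuousOn_of_continuous (s := Icc 0 t) hB.continuousOn) ε hε
  have hδ : Tendsto (fun n : ℕ => t / 2 ^ n) atTop (𝓝 0) := by
    have := (tendsto_pow_atTop_nhds_zero_of_lt_one (r := (1 / 2 : ℝ))
      (by norm_num) (by norm_num)).const_mul t
    simpa [div_eq_mul_inv] using this
  obtain ⟨N, hN⟩ := eventually_atTop.1 (hδ.eventually (gt_mem_nhds (lt_min hd₁ hd₂)))
  refine ⟨N, fun n hn => ?_⟩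
  have hstep := hN n hn
  set p : ℕ → ℝ := fun i => (i : ℝ) * t / 2 ^ n with hp
  have hpsucc : ∀ i : ℕ, ((i : ℝ) + 1) * t / 2 ^ n = p (i + 1) := fun i => by simp [hp]
  have hp0 : p 0 = 0 := by simp [hp]
  have hple : ∀ i, p i ≤ p (i + 1) := fun i => by
    simp only [hp]; gcongr; simp
  have hpd : ∀ i, p (i + 1) - p i = t / 2 ^ n := fun i => by
    simp only [hp]; push_cast; ring
  have hpmem : ∀ i, i ≤ k n → p i ∈ Icc 0 t := fun i hi => by
    refine ⟨by positivity, (?_ : p i ≤ p (k n)).trans (hmem n).2⟩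
    simp only [hp]; gcongr
  have htel : x (p (k n)) ^ 2 - x 0 ^ 2 - dyadicSqSum B t n (k n) -
      (∫ s in (0 : ℝ)..p (k n), 2 * x s * β s) =
      ∑ i ∈ Finset.range (k n), (x (p (i + 1)) ^ 2 - x (p i) ^ 2 - (B (p (i + 1)) - B (p i)) ^ 2 -
        ∫ s in p i..p (i + 1), 2 * x s * β s) := by
    rw [Finset.sum_sub_distrib, Finset.sum_sub_distrib, Finset.sum_range_sub
      (fun i => x (p i) ^ 2), intervalIntegral.sum_integral_adjacent_intervals
      fun i hi => hsubx (hpmem i hi.le) (hpmem (i + 1) hi), hp0]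
    simp only [dyadicSqSum, hpsucc]
    rfl
  have hsumabs : ∑ i ∈ Finset.range (k n), ∫ s in p i..p (i + 1), |β s| ≤ M := by
    rw [intervalIntegral.sum_integral_adjacent_intervals
      fun i hi => (hsub (hpmem i hi.le) (hpmem (i + 1) hi)).abs, hp0, hM]
    exact intervalIntegral.integral_mono_interval le_rfl (hpmem _ le_rfl).1 (hpmem _ le_rfl).2
      (ae_of_all _ fun _ => abs_nonneg _) hβ.abs
  simp only [hpsucc]
  change dist (dist (x (p (k n)) ^ 2 - x 0 ^ 2 - dyadicSqSum B t n (k n) -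
      (∫ s in (0 : ℝ)..p (k n), 2 * x s * β s))
    (∑ i ∈ Finset.range (k n), 2 * x (p i) * (B (p (i + 1)) - B (p i)))) 0 < η
  rw [Real.dist_0_eq_abs, abs_of_nonneg dist_nonneg, dist_comm, Real.dist_eq, htel,
    ← Finset.sum_sub_distrib]
  refine lt_of_le_of_lt (Finset.abs_sum_le_sum_abs _ _) (lt_of_le_of_lt ?_ hεM)
  calc _ ≤ ∑ i ∈ Finset.range (k n), 4 * ε * ∫ s in p i..p (i + 1), |β s| := by
        refine Finset.sum_le_sum fun i hi => ?_
        have hi' := Finset.mem_range.1 hi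
        have ha := hpmem i hi'.le
        have hc := hpmem (i + 1) hi'
        have hlt : p (i + 1) - p i < min d₁ d₂ := by rw [hpd]; exact hstep
        refine abs_sq_increment_error_le hx (hple i) (hsub ha hc) ?_ (fun s hs => ?_) ?_
        · rw [hxB _ hc, hxB _ ha, ← intervalIntegral.integral_interval_sub_left
            (hsub h0 hc) (hsub h0 ha)]
          ring
        · refine (hux s ⟨ha.1.trans hs.1, hs.2.trans hc.2⟩ _ ha ?_).le
          rw [Real.dist_eq, abs_of_nonneg (sub_nonneg.2 hs.1)]
          linarith [hs.2, min_le_left d₁ d₂]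
        · refine (huB _ hc _ ha ?_).le
          rw [Real.dist_eq, abs_of_nonneg (sub_nonneg.2 (hple i))]
          linarith [min_le_right d₁ d₂]
    _ ≤ 4 * ε * M := by
        rw [← Finset.mul_sum]
        gcongr

lemma two_mul_self_mul_bSing (f : ℝ → ℝ) {x : ℝ} (hx : |x| ≤ 1) :
    2 * x * bSing f x = (if x = 0 then 1 else 0) - 1 := by
  by_cases h : x = 0
  · simp [h]
  · simp only [bSing, h, hx, ne_eq, not_false_eq_true, and_self, if_true, if_false]
    field_simp
    norm_num

/-- Itô's formula for `x ↦ x²` applied to a weak solution of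
`dX = bSing f (X) dt + dB` with `X₀ = 0`, stopped at
`τ = inf {s ≥ 0 : |X s| ≥ 1}` (capped at `1/2`): almost surely
`X²_{t ∧ τ} = ∫₀^{t∧τ} 2 X dB + ∫₀^{t∧τ} 1_{X=0} ds`. -/
theorem stmt10 (f : ℝ → ℝ) (hf : Measurable f)
    {Ω : Type*} [m : MeasurableSpace Ω] (P : Measure Ω) [IsProbabilityMeasure P]
    (F : ℝ → MeasurableSpace Ω) (X B : ℝ → Ω → ℝ)
    (hsol : IsWeakSolutionOn F P (fun _ x => bSing f x) X B (fun _ => 0) (1/2))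
    (τ : Ω → ℝ) (hτ : ∀ ω, τ ω = sInf ({s : ℝ | 0 ≤ s ∧ 1 ≤ |X s ω|} ∪ {1/2}))
    (I : ℝ → Ω → ℝ)
    (hI : IsItoIntegral P B
      (fun s ω => if s ≤ τ ω then 2 * X s ω else 0) I) :
    ∀ t ∈ Icc (0:ℝ) (1/2), ∀ᵐ ω ∂P,
      (X (min t (τ ω)) ω) ^ 2 =
        I t ω + ∫ s in (0:ℝ)..(min t (τ ω)),
          Set.indicator {s : ℝ | X s ω = 0} (fun _ => (1:ℝ)) s := by
  intro t ht
  obtain ⟨hFm, hF, hB, hXc, -, hX0, hsde⟩ := hsol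
  have hne : ∀ ω, ({s : ℝ | 0 ≤ s ∧ 1 ≤ |X s ω|} ∪ {1/2}).Nonempty := fun ω => ⟨1/2, Or.inr rfl⟩
  have hlb : ∀ ω, ∀ s ∈ ({s : ℝ | 0 ≤ s ∧ 1 ≤ |X s ω|} ∪ {1/2}), (0:ℝ) ≤ s := by
    rintro ω s (hs | hs)
    · exact hs.1
    · rw [hs]; norm_num
  have hτ0 : ∀ ω, 0 ≤ τ ω := fun ω => by rw [hτ]; exact le_csInf (hne ω) (hlb ω)
  have hlt : ∀ ω s, 0 ≤ s → s < τ ω → |X s ω| ≤ 1 := fun ω s hs hsτ => by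
    by_contra! h
    rw [hτ] at hsτ
    exact absurd (csInf_le ⟨0, hlb ω⟩ (Or.inl ⟨hs, h.le⟩)) hsτ.not_ge
  obtain ⟨ns, hns, hconv⟩ := (hI t ht.1).exists_seq_tendsto_ae
  rcases ht.1.eq_or_lt with rfl | ht0
  · filter_upwards [hX0, hconv] with ω h0 hc
    have : I 0 ω = 0 := tendsto_nhds_unique hc (by simp)
    simp [min_eq_left (hτ0 ω), h0, this]
  filter_upwards [hX0, hconv, hsde, hB.ae_forall_tendsto_dyadicSqSum hFm hF ht0]
    with ω h0 hc hs hq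
  have hβ : IntervalIntegrable (fun s => bSing f (X s ω)) volume 0 t :=
    (intervalIntegrable_iff_integrableOn_Icc_of_le ht0.le).2 (hs t ht).1
  have hσ : min t (max (τ ω) 0) = min t (τ ω) := by rw [max_eq_left (hτ0 ω)]
  have hlim := tendsto_dyadic_ito_sq ht0 (hXc ω) (hB.1 ω) hβ
    (fun s hs' => by simpa using (hs s ⟨hs'.1, hs'.2.trans ht.2⟩).2)
    (fun n => dyadicCount_le t n (τ ω)) (tendsto_dyadicCount ht0 (τ ω)) (hq (τ ω))
  rw [hσ] at hlim
  have hIeq := tendsto_nhds_unique hc ((hlim.comp hns.tendsto_atTop).congr fun j => by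
    have hsub : Finset.range (dyadicCount t (ns j) (τ ω)) ⊆ Finset.range (2 ^ ns j) :=
      Finset.range_mono (dyadicCount_le t (ns j) (τ ω))
    rw [← Finset.sum_subset hsub fun i hi hi' => ?_]
    · refine Finset.sum_congr rfl fun i hi => ?_
      rw [if_pos ((lt_dyadicCount_iff ht0 (hτ0 ω) (Finset.mem_range.1 (hsub hi))).1
        (Finset.mem_range.1 hi))]
    · rw [if_neg fun h => hi' (Finset.mem_range.2
        ((lt_dyadicCount_iff ht0 (hτ0 ω) (Finset.mem_range.1 hi)).2 h)), zero_mul])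
  have hσ0 : 0 ≤ min t (τ ω) := le_min ht0.le (hτ0 ω)
  have hdrift : ∫ s in (0:ℝ)..(min t (τ ω)), 2 * X s ω * bSing f (X s ω) =
      (∫ s in (0:ℝ)..(min t (τ ω)), Set.indicator {s : ℝ | X s ω = 0} (fun _ => (1:ℝ)) s) -
        min t (τ ω) := by
    have hmeas : MeasurableSet {s : ℝ | X s ω = 0} :=
      (isClosed_singleton.preimage (hXc ω)).measurableSet
    have hint : IntervalIntegrable (Set.indicator {s : ℝ | X s ω = 0} (fun _ => (1:ℝ))) volume 0
        (min t (τ ω)) := by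
      rw [intervalIntegrable_iff]
      exact (integrableOn_const (by simp)).indicator hmeas
    rw [intervalIntegral.integral_congr_Ioo_of_le (g := fun s =>
      Set.indicator {s : ℝ | X s ω = 0} (fun _ => (1:ℝ)) s - 1) hσ0 fun s hs' => ?_,
      intervalIntegral.integral_sub hint (by simp)]
    · simp
    · have := two_mul_self_mul_bSing f
        (hlt ω s hs'.1.le (hs'.2.trans_le (min_le_right _ _)))
      simpa [Set.indicator_apply] using this
  rw [hIeq, hdrift, h0]
  ring
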